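/- Let 0 < λ < 1, 0 < δ < 1/2, m > 0. Suppose Ω minimizes E_{λ,δ} over sets of finite perimeter with |Ω| = π, where E_{λ,δ}(Ω) = P(Ω) − (λ/(4|log δ|)) ∫∫ |χ_Ω(x+z) − χ_Ω(x)|² g_δ(|z|)/|z|³ dz dx. Then there is a universal constant C > 0 such that P(Ω) − 2π ≤ Cλ/((1−λ)|log δ|); i.e. the isoperimetric deficit of a minimizer of mass π is at most Cλ/((1−λ)|log δ|). -/

import Mathlib

open MeasureTheory Real Filter Set

noncomputable section

/-- The plane `ℝ²`. -/
abbrev Plane := EuclideanSpace ℝ (Fin 2)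

/-- Divergence of a vector field on the plane. -/
def divg (φ : Plane → Plane) (x : Plane) : ℝ :=
  ∑ i : Fin 2, fderiv ℝ φ x (EuclideanSpace.single i 1) i

/-- The set of values `∫_Ω div φ` over admissible test vector fields. -/
def perimVals (Ω : Set Plane) : Set ℝ :=
  {s | ∃ φ : Plane → Plane, ContDiff ℝ 1 φ ∧ HasCompactSupport φ ∧
        (∀ x, ‖φ x‖ ≤ 1) ∧ s = ∫ x in Ω, divg φ x}

/-- The De Giorgi perimeter of a set in the plane. -/
def perim (Ω : Set Plane) : ℝ := sSup (perimVals Ω)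

/-- A set has finite perimeter if the defining supremum is finite. -/
def HasFinPer (Ω : Set Plane) : Prop := BddAbove (perimVals Ω)

/-- The cutoff function `g_δ(r) = χ_{(δ,∞)}(r)`. -/
def gdel (δ r : ℝ) : ℝ := if δ < r then 1 else 0

/-- Characteristic function of a set. -/
def ind (Ω : Set Plane) : Plane → ℝ := Set.indicator Ω 1

/-- The (rescaled) nonlocal dipolar term. -/
def nlE (δ : ℝ) (Ω : Set Plane) : ℝ :=
  ∫ x : Plane, ∫ z : Plane, |ind Ω (x + z) - ind Ω x| ^ 2 * (gdel δ ‖z‖ / ‖z‖ ^ 3)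

/-- The energy `E_{λ,δ}`. -/
def Eenergy (lam δ : ℝ) (Ω : Set Plane) : ℝ :=
  perim Ω - lam / (4 * |Real.log δ|) * nlE δ Ω

end

theorem Plane.volume_real_ball : (volume : Measure Plane).real (Metric.ball 0 1) = π := by
  rw [measureReal_def, EuclideanSpace.volume_ball_fin_two]
  simp [Real.pi_pos.le]

theorem Plane.integral_fun_norm (f : ℝ → ℝ) :
    ∫ x : Plane, f ‖x‖ = 2 * π * ∫ r in Ioi (0 : ℝ), r * f r := by
  rw [integral_fun_norm_addHaar, Plane.volume_real_ball]
  simp [mul_assoc]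

theorem Plane.integrable_fun_norm {f : ℝ → ℝ}
    (hf : IntegrableOn (fun r => r * f r) (Ioi 0)) : Integrable (fun x : Plane => f ‖x‖) := by
  rw [integrable_fun_norm_addHaar]
  simpa using hf

theorem continuous_divg {φ : Plane → Plane} (hφ : ContDiff ℝ 1 φ) : Continuous (divg φ) := by
  have := hφ.continuous_fderiv one_ne_zero
  unfold divg
  fun_prop

theorem hasCompactSupport_divg {φ : Plane → Plane} (hc : HasCompactSupport φ) :
    HasCompactSupport (divg φ) := by
  refine (hc.fderiv (𝕜 := ℝ)).mono fun x hx => ?_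
  contrapose! hx
  simp only [Function.mem_support, not_not] at hx ⊢
  simp [divg, hx]

theorem integrable_divg {φ : Plane → Plane} (hφ : ContDiff ℝ 1 φ) (hc : HasCompactSupport φ) :
    Integrable (divg φ) :=
  (continuous_divg hφ).integrable_of_hasCompactSupport (hasCompactSupport_divg hc)

/-- Integration by parts of a `C¹` scalar function against a divergence. -/
theorem integral_mul_divg {φ : Plane → Plane} (hφ : ContDiff ℝ 1 φ) (hc : HasCompactSupport φ)
    {u : Plane → ℝ} (hu : ContDiff ℝ 1 u) :
    ∫ x, u x * divg φ x = - ∫ x, fderiv ℝ u x (φ x) := by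
  have hdφ := hφ.continuous_fderiv one_ne_zero
  have hdu := hu.continuous_fderiv one_ne_zero
  have hcu := hu.continuous
  have hcφ := hφ.continuous
  have hdiff : Differentiable ℝ φ := hφ.differentiable one_ne_zero
  have hcomp (i : Fin 2) (x : Plane) : fderiv ℝ (fun y => φ y i) x (EuclideanSpace.single i 1)
      = fderiv ℝ φ x (EuclideanSpace.single i 1) i := by
    have := ((EuclideanSpace.proj (𝕜 := ℝ) i).hasFDerivAt.comp x (hdiff x).hasFDerivAt).fderiv
    have h2 : fderiv ℝ (fun y => φ y i) x = _ := this
    rw [h2]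
    simp
  have hci (i : Fin 2) : HasCompactSupport (fun y => φ y i) :=
    hc.comp_left (g := fun v : Plane => v i) rfl
  have hI1 (i : Fin 2) : Integrable
      (fun x => u x * fderiv ℝ (fun y => φ y i) x (EuclideanSpace.single i 1)) := by
    refine Continuous.integrable_of_hasCompactSupport ?_ ?_
    · simp only [hcomp]; fun_prop
    · exact ((hci i).fderiv_apply ℝ _).mul_left
  have hI2 (i : Fin 2) : Integrable
      (fun x => fderiv ℝ u x (EuclideanSpace.single i 1) * φ x i) :=
    Continuous.integrable_of_hasCompactSupport (by fun_prop) (hci i).mul_left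
  have hI3 (i : Fin 2) : Integrable (fun x => u x * φ x i) :=
    Continuous.integrable_of_hasCompactSupport (by fun_prop) (hci i).mul_left
  have key (i : Fin 2) := integral_mul_fderiv_eq_neg_fderiv_mul_of_integrable (hI2 i) (hI1 i)
    (hI3 i) (fun x _ => hu.differentiable one_ne_zero x)
    (fun x _ => (by fun_prop : Differentiable ℝ (fun y => φ y i)) x)
  have e1 : ∀ x, u x * divg φ x = ∑ i : Fin 2,
      u x * fderiv ℝ (fun y => φ y i) x (EuclideanSpace.single i 1) := by
    intro x; simp only [hcomp, divg, Finset.mul_sum]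
  have e2 : ∀ x, fderiv ℝ u x (φ x) = ∑ i : Fin 2,
      fderiv ℝ u x (EuclideanSpace.single i 1) * φ x i := by
    intro x
    have : φ x = ∑ i : Fin 2, φ x i • EuclideanSpace.single i (1 : ℝ) := by
      ext j; fin_cases j <;> simp [Fin.sum_univ_two]
    conv_lhs => rw [this]
    simp [mul_comm]
  simp only [e1, e2]
  rw [integral_finsetSum _ (fun i _ => hI1 i), integral_finsetSum _ (fun i _ => hI2 i),
    ← Finset.sum_neg_distrib]
  exact Finset.sum_congr rfl fun i _ => key i

theorem Plane.integral_smooth_cutoff_deriv_le {k : ℝ} (hk : 0 < k) :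
    IntegrableOn (fun r => r * (2 * k * deriv smoothTransition (k * (1 - r ^ 2)) * r)) (Ioi 0) ∧
    ∫ r in Ioi (0 : ℝ), r * (2 * k * deriv smoothTransition (k * (1 - r ^ 2)) * r) ≤ 1 := by
  have hS : ContDiff ℝ 1 smoothTransition := Real.smoothTransition.contDiff (n := 1)
  have hdS : Continuous (deriv smoothTransition) := hS.continuous_deriv le_rfl
  set F : ℝ → ℝ := fun r => r * (2 * k * deriv smoothTransition (k * (1 - r ^ 2)) * r) with hF
  have hFc : Continuous F := by fun_prop
  have h0 : ∀ s ≤ 0, deriv smoothTransition s = 0 := by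
    intro s hs
    have : IsLocalMin smoothTransition s := by
      refine Filter.Eventually.of_forall fun t => ?_
      simp only [smoothTransition.zero_of_nonpos hs, smoothTransition.nonneg]
    exact this.deriv_eq_zero
  have hpos : ∀ s, 0 ≤ deriv smoothTransition s := fun s => smoothTransition.monotone.deriv_nonneg
  have hF0 : ∀ r ∈ Ioi (0 : ℝ) \ Ioc 0 1, F r = 0 := by
    rintro r ⟨hr, hr'⟩
    have hr1 : 1 < r := by
      by_contra! h; exact hr' ⟨hr, h⟩
    simp only [hF]
    rw [h0 _ (mul_nonpos_of_nonneg_of_nonpos hk.le (by nlinarith))]; ring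
  have hInt : IntegrableOn F (Ioc 0 1) := (hFc.integrableOn_Icc).mono_set Ioc_subset_Icc_self
  have hsub : Ioc (0 : ℝ) 1 ⊆ Ioi 0 := Ioc_subset_Ioi_self
  refine ⟨hInt.of_forall_sdiff_eq_zero measurableSet_Ioi hF0, ?_⟩
  rw [setIntegral_eq_of_subset_of_forall_sdiff_eq_zero measurableSet_Ioi hsub hF0]
  have hder : ∀ r ∈ uIcc (0 : ℝ) 1, HasDerivAt (fun r => - smoothTransition (k * (1 - r ^ 2)))
      (2 * k * deriv smoothTransition (k * (1 - r ^ 2)) * r) r := by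
    intro r _
    have h1 : HasDerivAt (fun r : ℝ => k * (1 - r ^ 2)) (k * (-(2 * r))) r := by
      simpa using ((hasDerivAt_pow 2 r).const_sub 1).const_mul k
    have h2 := ((hS.differentiable one_ne_zero _).hasDerivAt.comp r h1).neg
    refine h2.congr_deriv ?_
    ring
  have hftc := intervalIntegral.integral_eq_sub_of_hasDerivAt hder
    (Continuous.intervalIntegrable (by fun_prop) 0 1)
  rw [intervalIntegral.integral_of_le zero_le_one] at hftc
  calc ∫ r in Ioc (0 : ℝ) 1, F r
      ≤ ∫ r in Ioc (0 : ℝ) 1, 2 * k * deriv smoothTransition (k * (1 - r ^ 2)) * r := by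
        refine setIntegral_mono_on hInt ?_ measurableSet_Ioc ?_
        · exact (Continuous.integrableOn_Icc (by fun_prop)).mono_set Ioc_subset_Icc_self
        · rintro r ⟨hr0, hr1⟩
          have := mul_nonneg (mul_nonneg (mul_nonneg zero_le_two hk.le)
            (hpos (k * (1 - r ^ 2)))) hr0.le
          simp only [hF]
          nlinarith
    _ ≤ 1 := by
        rw [hftc]
        simp [smoothTransition.le_one]

theorem setIntegral_ball_divg_le {φ : Plane → Plane} (hφ : ContDiff ℝ 1 φ)
    (hc : HasCompactSupport φ) (h1 : ∀ x, ‖φ x‖ ≤ 1) :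
    ∫ x in Metric.ball (0 : Plane) 1, divg φ x ≤ 2 * π := by
  have hS : ContDiff ℝ 1 smoothTransition := Real.smoothTransition.contDiff (n := 1)
  have hpos : ∀ s, 0 ≤ deriv smoothTransition s := fun s => smoothTransition.monotone.deriv_nonneg
  set u : ℕ → Plane → ℝ := fun k x => smoothTransition ((k + 1 : ℝ) * (1 - ‖x‖ ^ 2)) with hu
  have hui (k : ℕ) : ContDiff ℝ 1 (u k) := by
    refine hS.comp ?_
    exact contDiff_const.mul (contDiff_const.sub (contDiff_norm_sq ℝ))
  have hbound (k : ℕ) : ∫ x, u k x * divg φ x ≤ 2 * π := by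
    have hk : (0 : ℝ) < k + 1 := by positivity
    obtain ⟨hI, hle⟩ := Plane.integral_smooth_cutoff_deriv_le hk
    rw [integral_mul_divg hφ hc (hui k), ← integral_neg]
    have hle2 : ∫ x : Plane, (2 * (k + 1 : ℝ) *
        deriv smoothTransition ((k + 1 : ℝ) * (1 - ‖x‖ ^ 2)) * ‖x‖) ≤ 2 * π := by
      rw [Plane.integral_fun_norm
        (fun r => 2 * (k + 1 : ℝ) * deriv smoothTransition ((k + 1 : ℝ) * (1 - r ^ 2)) * r)]
      nlinarith [Real.pi_pos]
    refine (integral_mono ?_ (Plane.integrable_fun_norm hI) fun x => ?_).trans hle2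
    · refine Integrable.neg (Continuous.integrable_of_hasCompactSupport ?_ ?_)
      · have := (hui k).continuous_fderiv one_ne_zero
        have := hφ.continuous
        fun_prop
      · refine hc.mono fun x hx => ?_
        contrapose! hx
        simp only [Function.mem_support, not_not] at hx ⊢
        simp [hx]
    · have hd : HasFDerivAt (u k)
          ((deriv smoothTransition ((k + 1 : ℝ) * (1 - ‖x‖ ^ 2))) •
            ((k + 1 : ℝ) • (-((2 : ℕ) • innerSL ℝ x : Plane →L[ℝ] ℝ)))) x := by
        have h2 := (((hasStrictFDerivAt_norm_sq x).hasFDerivAt.const_sub 1).const_mul (k + 1 : ℝ))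
        exact (hS.differentiable one_ne_zero _).hasDerivAt.comp_hasFDerivAt x h2
      simp only [hd.fderiv]
      have hin : |inner ℝ x (φ x)| ≤ ‖x‖ :=
        (abs_real_inner_le_norm x (φ x)).trans (by nlinarith [h1 x, norm_nonneg x])
      have hc0 := mul_nonneg hk.le (hpos ((k + 1 : ℝ) * (1 - ‖x‖ ^ 2)))
      have := mul_le_mul_of_nonneg_left (le_of_abs_le hin) hc0
      simp
      nlinarith
  have hlim : Tendsto (fun k => ∫ x, u k x * divg φ x) atTop
      (nhds (∫ x, (Metric.ball (0 : Plane) 1).indicator (divg φ) x)) := by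
    refine tendsto_integral_of_dominated_convergence (fun x => |divg φ x|) (fun k => ?_)
      (integrable_divg hφ hc).abs (fun k => ?_) ?_
    · exact ((hui k).continuous.mul (continuous_divg hφ)).aestronglyMeasurable
    · refine Filter.Eventually.of_forall fun x => ?_
      rw [norm_mul, Real.norm_eq_abs, Real.norm_eq_abs, abs_of_nonneg (smoothTransition.nonneg _)]
      exact mul_le_of_le_one_left (abs_nonneg _) (smoothTransition.le_one _)
    · refine Filter.Eventually.of_forall fun x => ?_
      by_cases hx : x ∈ Metric.ball (0 : Plane) 1
      · rw [indicator_of_mem hx]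
        have hx' : ‖x‖ < 1 := by simpa using hx
        have hp : 0 < 1 - ‖x‖ ^ 2 := by nlinarith [norm_nonneg x]
        obtain ⟨N, hN⟩ := exists_nat_gt (1 / (1 - ‖x‖ ^ 2))
        refine tendsto_const_nhds.congr' ?_
        filter_upwards [eventually_ge_atTop N] with k hk
        have : (N : ℝ) ≤ k := by exact_mod_cast hk
        rw [div_lt_iff₀ hp] at hN
        simp only [hu]
        rw [smoothTransition.one_of_one_le (by nlinarith), one_mul]
      · rw [indicator_of_notMem hx]
        have hx' : 1 ≤ ‖x‖ := by simpa using hx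
        refine tendsto_const_nhds.congr fun k => ?_
        simp only [hu]
        have : (0 : ℝ) < k + 1 := by positivity
        rw [smoothTransition.zero_of_nonpos (mul_nonpos_of_nonneg_of_nonpos this.le (by nlinarith)),
          zero_mul]
  rw [integral_indicator measurableSet_ball] at hlim
  exact le_of_tendsto' hlim hbound

theorem hasFinPer_ball : HasFinPer (Metric.ball (0 : Plane) 1) := by
  refine ⟨2 * π, ?_⟩
  rintro s ⟨φ, hφ, hc, h1, rfl⟩
  exact setIntegral_ball_divg_le hφ hc h1

theorem perim_ball_le : perim (Metric.ball (0 : Plane) 1) ≤ 2 * π := by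
  refine csSup_le ⟨_, 0, contDiff_const, HasCompactSupport.zero, by simp, rfl⟩ ?_
  rintro s ⟨φ, hφ, hc, h1, rfl⟩
  exact setIntegral_ball_divg_le hφ hc h1

theorem exists_bound_fderiv {u : Plane → ℝ} (hu : ContDiff ℝ 1 u) (hc : HasCompactSupport u) :
    ∃ L, ∀ x, ‖fderiv ℝ u x‖ ≤ L :=
  (hc.fderiv (𝕜 := ℝ)).exists_bound_of_continuous (hu.continuous_fderiv one_ne_zero)

/-- The measure `dz dt` on `{‖z‖ ≤ 1} × [0, 1]`. -/
noncomputable def segMeasure : Measure (Plane × ℝ) :=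
  ((volume : Measure Plane).restrict (Metric.closedBall 0 1)).prod
    ((volume : Measure ℝ).restrict (Icc 0 1))

instance : IsFiniteMeasure segMeasure := by
  have : IsFiniteMeasure ((volume : Measure Plane).restrict (Metric.closedBall 0 1)) :=
    isFiniteMeasure_restrict.2 measure_closedBall_lt_top.ne
  unfold segMeasure
  infer_instance

/-- The field whose divergence is `∫ (u (x + z) - u x) K z dz`. -/
noncomputable def segField (K u : Plane → ℝ) (x : Plane) : Plane :=
  ∫ p, u (x + p.2 • p.1) • (K p.1 • p.1) ∂segMeasure

section Field

variable {K u : Plane → ℝ} {M : ℝ}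

theorem hasFDerivAt_segField (hK : Measurable K) (hM : ∀ z, ‖K z • z‖ ≤ M)
    (hu : ContDiff ℝ 1 u) (hc : HasCompactSupport u) (x : Plane) :
    HasFDerivAt (segField K u)
      (∫ p, (fderiv ℝ u (x + p.2 • p.1)).smulRight (K p.1 • p.1) ∂segMeasure) x := by
  obtain ⟨L, hL⟩ := exists_bound_fderiv hu hc
  obtain ⟨U, hU⟩ := hc.exists_bound_of_continuous hu.continuous
  have hWm : Measurable fun p : Plane × ℝ => K p.1 • p.1 := by fun_prop
  have hmeas (x : Plane) : AEStronglyMeasurable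
      (fun p : Plane × ℝ => u (x + p.2 • p.1) • (K p.1 • p.1)) segMeasure := by
    have := hu.continuous.measurable
    exact Measurable.aestronglyMeasurable (by fun_prop)
  have hdu := hu.continuous_fderiv one_ne_zero
  refine hasFDerivAt_integral_of_dominated_of_fderiv_le (𝕜 := ℝ) (s := univ)
    (F' := fun x p => (fderiv ℝ u (x + p.2 • p.1)).smulRight (K p.1 • p.1))
    (bound := fun _ => L * M) univ_mem (Filter.Eventually.of_forall hmeas) ?_ ?_ ?_
    (integrable_const _) ?_
  · refine Integrable.mono' (integrable_const (U * M)) (hmeas x) ?_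
    refine Filter.Eventually.of_forall fun p => ?_
    rw [norm_smul]
    exact mul_le_mul (hU _) (hM _) (norm_nonneg _) ((norm_nonneg _).trans (hU 0))
  · have h1 : Continuous fun q : (Plane →L[ℝ] ℝ) × Plane => q.1.smulRight q.2 := by fun_prop
    have h2 : Measurable fun p : Plane × ℝ => fderiv ℝ u (x + p.2 • p.1) := by
      have := hdu.measurable
      fun_prop
    exact (h1.measurable.comp (h2.prodMk hWm)).aestronglyMeasurable
  · refine Filter.Eventually.of_forall fun p y _ => ?_
    rw [ContinuousLinearMap.norm_smulRight_apply]
    exact mul_le_mul (hL _) (hM _) (norm_nonneg _) ((norm_nonneg _).trans (hL 0))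
  · refine Filter.Eventually.of_forall fun p y _ => ?_
    have h := (hu.differentiable one_ne_zero (y + p.2 • p.1)).hasFDerivAt
    have h2 := h.comp y ((hasFDerivAt_id (𝕜 := ℝ) y).add_const (p.2 • p.1))
    have h3 : HasFDerivAt (fun y => u (y + p.2 • p.1)) (fderiv ℝ u (y + p.2 • p.1)) y := h2
    exact h3.smul_const (K p.1 • p.1)

theorem integrable_segField_deriv (hK : Measurable K) (hM : ∀ z, ‖K z • z‖ ≤ M)
    (hu : ContDiff ℝ 1 u) (hc : HasCompactSupport u) (x : Plane) :
    Integrable (fun p => (fderiv ℝ u (x + p.2 • p.1)).smulRight (K p.1 • p.1)) segMeasure := by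
  obtain ⟨L, hL⟩ := exists_bound_fderiv hu hc
  have hWm : Measurable fun p : Plane × ℝ => K p.1 • p.1 := by fun_prop
  have hdu := hu.continuous_fderiv one_ne_zero
  have h1 : Continuous fun q : (Plane →L[ℝ] ℝ) × Plane => q.1.smulRight q.2 := by fun_prop
  have h2 : Measurable fun p : Plane × ℝ => fderiv ℝ u (x + p.2 • p.1) := by
    have := hdu.measurable
    fun_prop
  refine Integrable.mono' (integrable_const (L * M))
    (h1.measurable.comp (h2.prodMk hWm)).aestronglyMeasurable ?_
  refine Filter.Eventually.of_forall fun p => ?_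
  rw [ContinuousLinearMap.norm_smulRight_apply]
  exact mul_le_mul (hL _) (hM _) (norm_nonneg _) ((norm_nonneg _).trans (hL 0))

theorem contDiff_segField (hK : Measurable K) (hM : ∀ z, ‖K z • z‖ ≤ M)
    (hu : ContDiff ℝ 1 u) (hc : HasCompactSupport u) : ContDiff ℝ 1 (segField K u) := by
  rw [contDiff_one_iff_hasFDerivAt]
  refine ⟨_, ?_, hasFDerivAt_segField hK hM hu hc⟩
  obtain ⟨L, hL⟩ := exists_bound_fderiv hu hc
  have hdu := hu.continuous_fderiv one_ne_zero
  refine continuous_of_dominated (bound := fun _ => L * M)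
    (fun x => (integrable_segField_deriv hK hM hu hc x).1) (fun x => ?_) (integrable_const _) ?_
  · refine Filter.Eventually.of_forall fun p => ?_
    rw [ContinuousLinearMap.norm_smulRight_apply]
    exact mul_le_mul (hL _) (hM _) (norm_nonneg _) ((norm_nonneg _).trans (hL 0))
  · refine Filter.Eventually.of_forall fun p => ?_
    fun_prop

theorem ae_segMeasure : ∀ᵐ p ∂segMeasure, p.1 ∈ Metric.closedBall (0 : Plane) 1 ∧
    p.2 ∈ Icc (0 : ℝ) 1 := by
  rw [segMeasure, Measure.prod_restrict]
  filter_upwards [ae_restrict_mem (measurableSet_closedBall.prod measurableSet_Icc)] with p hp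
  exact hp

theorem hasCompactSupport_segField (hc : HasCompactSupport u) :
    HasCompactSupport (segField K u) := by
  obtain ⟨R, hR⟩ := hc.isBounded.subset_closedBall 0
  refine HasCompactSupport.intro (isCompact_closedBall (0 : Plane) (R + 1)) fun x hx => ?_
  refine integral_eq_zero_of_ae ?_
  filter_upwards [ae_segMeasure] with p hp
  have : u (x + p.2 • p.1) = 0 := by
    by_contra h
    have h2 := hR (subset_tsupport _ h)
    apply hx
    simp only [mem_closedBall_zero_iff, mem_Icc] at *
    have h3 : ‖p.2 • p.1‖ ≤ 1 := by
      rw [norm_smul, Real.norm_eq_abs, abs_of_nonneg hp.2.1]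
      nlinarith [norm_nonneg p.1]
    calc ‖x‖ = ‖(x + p.2 • p.1) - p.2 • p.1‖ := by simp
      _ ≤ _ := norm_sub_le _ _
      _ ≤ R + 1 := by linarith
  simp [this]

/-- The trace functional on endomorphisms of the plane. -/
noncomputable def traceCLM : (Plane →L[ℝ] Plane) →L[ℝ] ℝ :=
  ∑ i : Fin 2, (EuclideanSpace.proj (𝕜 := ℝ) i).comp
    (ContinuousLinearMap.apply ℝ Plane (EuclideanSpace.single i (1 : ℝ)))

theorem traceCLM_apply (A : Plane →L[ℝ] Plane) :
    traceCLM A = ∑ i : Fin 2, A (EuclideanSpace.single i 1) i := by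
  simp [traceCLM]

theorem traceCLM_smulRight (l : Plane →L[ℝ] ℝ) (w : Plane) :
    traceCLM (l.smulRight w) = l w := by
  have : w = ∑ i : Fin 2, w i • EuclideanSpace.single i (1 : ℝ) := by
    ext j; fin_cases j <;> simp [Fin.sum_univ_two]
  rw [traceCLM_apply]
  conv_rhs => rw [this]
  simp [mul_comm]

theorem divg_segField (hK : Measurable K) (hM : ∀ z, ‖K z • z‖ ≤ M)
    (hK0 : ∀ z, 1 < ‖z‖ → K z = 0)
    (hu : ContDiff ℝ 1 u) (hc : HasCompactSupport u) (x : Plane) :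
    divg (segField K u) x = ∫ z, (u (x + z) - u x) * K z := by
  have hi := integrable_segField_deriv hK hM hu hc x
  have hdu := hu.continuous_fderiv one_ne_zero
  have h1 : divg (segField K u) x =
      ∫ p, fderiv ℝ u (x + p.2 • p.1) (K p.1 • p.1) ∂segMeasure := by
    rw [divg, ← traceCLM_apply, (hasFDerivAt_segField hK hM hu hc x).fderiv,
      ← ContinuousLinearMap.integral_comp_comm _ hi]
    simp only [traceCLM_smulRight]
  have hi2 : Integrable (fun p => fderiv ℝ u (x + p.2 • p.1) (K p.1 • p.1)) segMeasure := by
    simpa only [traceCLM_smulRight] using traceCLM.integrable_comp hi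
  rw [h1, segMeasure, integral_prod _ hi2]
  rw [← setIntegral_eq_integral_of_forall_compl_eq_zero (s := Metric.closedBall (0 : Plane) 1)
    (f := fun z => (u (x + z) - u x) * K z)]
  · refine integral_congr_ae (Filter.Eventually.of_forall fun z => ?_)
    simp only [map_smul, smul_eq_mul]
    rw [integral_const_mul, mul_comm]
    congr 1
    rw [integral_Icc_eq_integral_Ioc, ← intervalIntegral.integral_of_le zero_le_one]
    have hder : ∀ t ∈ uIcc (0 : ℝ) 1, HasDerivAt (fun t : ℝ => u (x + t • z))
        (fderiv ℝ u (x + t • z) z) t := by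
      intro t _
      have h2 : HasDerivAt (fun t : ℝ => x + t • z) z t := by
        simpa using ((hasDerivAt_id t).smul_const z).const_add x
      exact (hu.differentiable one_ne_zero _).hasFDerivAt.comp_hasDerivAt t h2
    rw [intervalIntegral.integral_eq_sub_of_hasDerivAt hder
      (Continuous.intervalIntegrable (by fun_prop) 0 1)]
    simp
  · intro z hz
    rw [hK0 z (by simpa using hz), mul_zero]

theorem integral_segMeasure_fst (hK0 : ∀ z, 1 < ‖z‖ → K z = 0) (f : Plane → ℝ) :
    ∫ p, K p.1 * f p.1 ∂segMeasure = ∫ z, K z * f z := by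
  rw [segMeasure, integral_fun_fst (fun z => K z * f z)]
  rw [setIntegral_eq_integral_of_forall_compl_eq_zero]
  · simp
  · intro z hz
    rw [hK0 z (by simpa using hz), zero_mul]

theorem norm_segField_le {c : ℝ} (hK : Measurable K) (hM : ∀ z, ‖K z • z‖ ≤ M)
    (hK0 : ∀ z, 1 < ‖z‖ → K z = 0) (hKn : ∀ z, 0 ≤ K z) (hKe : ∀ z, K (-z) = K z)
    (hcK : ∀ e : Plane, ‖e‖ = 1 → ∫ z, K z * |inner ℝ z e| ≤ c) (hc0 : 0 ≤ c)
    (hu : ContDiff ℝ 1 u) (hu0 : ∀ x, 0 ≤ u x) (hu1 : ∀ x, u x ≤ 1) (x : Plane) :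
    ‖segField K u x‖ ≤ c / 2 := by
  have hWm : Measurable fun p : Plane × ℝ => K p.1 • p.1 := by fun_prop
  have hum := hu.continuous.measurable
  have hI : Integrable (fun p => u (x + p.2 • p.1) • (K p.1 • p.1)) segMeasure := by
    refine Integrable.mono' (integrable_const (1 * M))
      (Measurable.aestronglyMeasurable (by fun_prop)) ?_
    refine Filter.Eventually.of_forall fun p => ?_
    rw [norm_smul, Real.norm_eq_abs, abs_of_nonneg (hu0 _)]
    exact mul_le_mul (hu1 _) (hM _) (norm_nonneg _) zero_le_one
  have hWi : Integrable (fun p : Plane × ℝ => K p.1 • p.1) segMeasure :=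
    Integrable.mono' (integrable_const M) hWm.aestronglyMeasurable
      (Filter.Eventually.of_forall fun p => hM _)
  have key (e : Plane) (he : ‖e‖ = 1) : inner ℝ e (segField K u x) ≤ c / 2 := by
    rw [segField, ← integral_inner hI]
    have hodd : ∫ p, K p.1 * inner ℝ p.1 e ∂segMeasure = 0 := by
      rw [integral_segMeasure_fst hK0 (fun z => inner ℝ z e)]
      have := integral_neg_eq_self (fun z : Plane => K z * inner ℝ z e) volume
      simp only [hKe, inner_neg_left, mul_neg, integral_neg] at this
      linarith
    have hWe : Integrable (fun p : Plane × ℝ => K p.1 * inner ℝ p.1 e) segMeasure := by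
      refine (hWi.inner_const e).congr (Filter.Eventually.of_forall fun p => ?_)
      simp [inner_smul_left]
    have hWa : Integrable (fun p : Plane × ℝ => K p.1 * |inner ℝ p.1 e|) segMeasure := by
      refine hWe.abs.congr (Filter.Eventually.of_forall fun p => ?_)
      simp [abs_mul, abs_of_nonneg (hKn _)]
    calc ∫ p, inner ℝ e (u (x + p.2 • p.1) • (K p.1 • p.1)) ∂segMeasure
        ≤ ∫ p, ((1 / 2 : ℝ) * (K p.1 * inner ℝ p.1 e)
            + (1 / 2 : ℝ) * (K p.1 * |inner ℝ p.1 e|)) ∂segMeasure := by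
          refine integral_mono (hI.const_inner e)
            ((hWe.const_mul _).add (hWa.const_mul _)) fun p => ?_
          simp only [inner_smul_right, real_inner_comm p.1 e]
          have hu0' := hu0 (x + p.2 • p.1)
          have hu1' := hu1 (x + p.2 • p.1)
          set s := u (x + p.2 • p.1)
          set w : ℝ := inner ℝ p.1 e
          have h1 : s * w ≤ 1 / 2 * w + 1 / 2 * |w| := by
            rcases abs_cases w with ⟨h, h'⟩ | ⟨h, h'⟩ <;> rw [h] <;> nlinarith
          nlinarith [mul_le_mul_of_nonneg_left h1 (hKn p.1)]
      _ = (1 / 2 : ℝ) * ∫ z, K z * |inner ℝ z e| := by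
          rw [integral_add (hWe.const_mul _) (hWa.const_mul _), integral_const_mul,
            integral_const_mul, hodd, integral_segMeasure_fst hK0 (fun z => |inner ℝ z e|)]
          ring
      _ ≤ c / 2 := by linarith [hcK e he]
  by_cases h0 : segField K u x = 0
  · rw [h0, norm_zero]; positivity
  · have hn : ‖segField K u x‖ ≠ 0 := norm_ne_zero_iff.2 h0
    have := key (‖segField K u x‖⁻¹ • segField K u x) (by rw [norm_smul]; simp [hn])
    rwa [inner_smul_left, real_inner_self_eq_norm_sq, pow_two, ← mul_assoc, conj_trivial,
      inv_mul_cancel₀ hn, one_mul] at this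

theorem setIntegral_smooth_diff_le_perim {c : ℝ} (hK : Measurable K) (hM : ∀ z, ‖K z • z‖ ≤ M)
    (hK0 : ∀ z, 1 < ‖z‖ → K z = 0) (hKn : ∀ z, 0 ≤ K z) (hKe : ∀ z, K (-z) = K z)
    (hcK : ∀ e : Plane, ‖e‖ = 1 → ∫ z, K z * |inner ℝ z e| ≤ c) (hc0 : 0 < c)
    (hu : ContDiff ℝ 1 u) (hc : HasCompactSupport u) (hu0 : ∀ x, 0 ≤ u x) (hu1 : ∀ x, u x ≤ 1)
    {Ω : Set Plane} (hΩ : HasFinPer Ω) :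
    ∫ x in Ω, ∫ z, (u x - u (x + z)) * K z ≤ c / 2 * perim Ω := by
  have hd := contDiff_segField hK hM hu hc
  have hmem : ∫ x in Ω, divg (fun y => (-(2 / c)) • segField K u y) x ∈ perimVals Ω := by
    refine ⟨_, hd.const_smul _, ?_, fun x => ?_, rfl⟩
    · exact (hasCompactSupport_segField hc).comp_left
        (g := fun v : Plane => (-(2 / c)) • v) (smul_zero _)
    have := norm_segField_le hK hM hK0 hKn hKe hcK hc0.le hu hu0 hu1 x
    rw [norm_smul, norm_neg, Real.norm_eq_abs, abs_of_pos (by positivity), div_mul_eq_mul_div,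
      div_le_one hc0]
    linarith
  have hle := le_csSup hΩ hmem
  have hdiv (x : Plane) : divg (fun y => (-(2 / c)) • segField K u y) x
      = (2 / c) * ∫ z, (u x - u (x + z)) * K z := by
    have h1 : divg (fun y => (-(2 / c)) • segField K u y) x
        = -(2 / c) * divg (segField K u) x := by
      simp only [divg]
      rw [fderiv_fun_const_smul (hd.differentiable one_ne_zero x)]
      simp [mul_add, add_comm]
    rw [h1, divg_segField hK hM hK0 hu hc, neg_mul, ← mul_neg, ← integral_neg]
    congr 2
    ext z; ring
  simp only [hdiv] at hle
  rw [integral_const_mul] at hle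
  change _ ≤ perim Ω at hle
  rw [div_mul_eq_mul_div, div_le_iff₀ hc0] at hle
  linarith

end Field

theorem measurable_ind {Ω : Set Plane} (hΩ : MeasurableSet Ω) : Measurable (ind Ω) :=
  measurable_one.indicator hΩ

theorem ind_nonneg (Ω : Set Plane) (x : Plane) : 0 ≤ ind Ω x :=
  indicator_nonneg (fun _ _ => zero_le_one) x

theorem ind_le_one (Ω : Set Plane) (x : Plane) : ind Ω x ≤ 1 :=
  indicator_le_self' (fun _ _ => zero_le_one) x

theorem integrable_ind {Ω : Set Plane} (hΩ : MeasurableSet Ω) (hv : volume Ω ≠ ⊤) :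
    Integrable (ind Ω) :=
  (integrable_indicator_iff hΩ).2 (integrableOn_const hv)

theorem integral_ind {Ω : Set Plane} (hΩ : MeasurableSet Ω) :
    ∫ x, ind Ω x = (volume : Measure Plane).real Ω := by
  rw [ind, integral_indicator_one hΩ]

theorem exists_smooth_approx_ind {Ω : Set Plane} (hΩ : MeasurableSet Ω) (hv : volume Ω ≠ ⊤)
    {ε : ℝ} (hε : 0 < ε) :
    ∃ u : Plane → ℝ, ContDiff ℝ 1 u ∧ HasCompactSupport u ∧ (∀ x, 0 ≤ u x) ∧ (∀ x, u x ≤ 1) ∧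
      ∫ x, |ind Ω x - u x| ≤ ε := by
  have hε2 : ENNReal.ofReal (ε / 2) ≠ 0 := by simpa using hε
  obtain ⟨F, hFΩ, hF, hFv⟩ := hΩ.exists_isCompact_sdiff_lt hv hε2
  have hFt : volume F ≠ ⊤ := hF.measure_lt_top.ne
  obtain ⟨U, hFU, hU, hUv⟩ := F.exists_isOpen_lt_add hFt hε2
  obtain ⟨R, hR⟩ := hF.isBounded.subset_ball 0
  obtain ⟨u, hud, hur, hus, hu1⟩ := exists_contMDiff_support_eq_eq_one_iff (n := (1 : ℕ∞))
    (modelWithCornersSelf ℝ Plane) (hU.inter (Metric.isOpen_ball (x := (0 : Plane)) (ε := R)))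
    hF.isClosed (subset_inter hFU hR)
  have hu0' (x : Plane) : 0 ≤ u x := (hur ⟨x, rfl⟩).1
  have hu1' (x : Plane) : u x ≤ 1 := (hur ⟨x, rfl⟩).2
  have hud' : ContDiff ℝ 1 u := contMDiff_iff_contDiff.1 hud
  have huc : HasCompactSupport u := by
    refine HasCompactSupport.intro (isCompact_closedBall (0 : Plane) R) fun x hx => ?_
    by_contra h
    have : x ∈ Function.support u := h
    rw [hus] at this
    exact hx (Metric.ball_subset_closedBall this.2)
  refine ⟨u, hud', huc, hu0', hu1', ?_⟩
  have hUF : volume (U \ F) ≤ ENNReal.ofReal (ε / 2) := by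
    rw [measure_sdiff hFU hF.measurableSet.nullMeasurableSet hFt]
    exact tsub_le_iff_left.2 hUv.le
  have m1 := hΩ.diff hF.measurableSet
  have m2 := hU.measurableSet.diff hF.measurableSet
  have t1 : volume (Ω \ F) ≠ ⊤ := (hFv.trans ENNReal.ofReal_lt_top).ne
  have t2 : volume (U \ F) ≠ ⊤ := (hUF.trans_lt ENNReal.ofReal_lt_top).ne
  have i1 := integrable_ind m1 t1
  have i2 := integrable_ind m2 t2
  calc ∫ x, |ind Ω x - u x| ≤ ∫ x, (ind (Ω \ F) x + ind (U \ F) x) := by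
        refine integral_mono (((integrable_ind hΩ hv).sub
          (hud'.continuous.integrable_of_hasCompactSupport huc)).abs) (i1.add i2) fun x => ?_
        have hU0 : x ∉ U → u x = 0 := fun h => by
          by_contra h'
          have : x ∈ Function.support u := h'
          rw [hus] at this
          exact h this.1
        have h0 := hu0' x
        have h1 := hu1' x
        simp only [ind]
        by_cases hxF : x ∈ F
        · simp [hxF, hFΩ hxF, (hu1 x).1 hxF]
        · by_cases hxΩ : x ∈ Ω <;> by_cases hxU : x ∈ U
          · have hx1 : x ∈ Ω \ F := ⟨hxΩ, hxF⟩
            have hx2 : x ∈ U \ F := ⟨hxU, hxF⟩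
            rw [indicator_of_mem hxΩ, indicator_of_mem hx1, indicator_of_mem hx2]
            simp only [Pi.one_apply]
            rw [abs_le]; constructor <;> linarith
          · simp [hxF, hxΩ, hxU, hU0 hxU]
          · simp [hxF, hxΩ, hxU, abs_of_nonneg h0, h1]
          · simp [hxF, hxΩ, hxU, hU0 hxU]
    _ = volume.real (Ω \ F) + volume.real (U \ F) := by
        rw [integral_add i1 i2, integral_ind m1, integral_ind m2]
    _ ≤ ε / 2 + ε / 2 := add_le_add
        (ENNReal.toReal_le_of_le_ofReal (by positivity) hFv.le)
        (ENNReal.toReal_le_of_le_ofReal (by positivity) hUF)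
    _ = ε := by ring

section Shear

variable {f K : Plane → ℝ}

theorem integrable_shear (hfm : Measurable f) (hf : Integrable f) (hKm : Measurable K)
    (hK : Integrable K) :
    Integrable (fun p : Plane × Plane => f (p.1 + p.2) * K p.2) (volume.prod volume) := by
  rw [integrable_prod_iff' (Measurable.aestronglyMeasurable (by fun_prop))]
  refine ⟨Filter.Eventually.of_forall fun z => (hf.comp_add_right z).mul_const (K z), ?_⟩
  simp only [norm_mul]
  have (z : Plane) : ∫ x, ‖f (x + z)‖ * ‖K z‖ = (∫ x, ‖f x‖) * ‖K z‖ := by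
    rw [integral_mul_const, integral_add_right_eq_self (fun x => ‖f x‖)]
  simp only [this]
  exact hK.norm.const_mul _

theorem integral_shear (hfm : Measurable f) (hf : Integrable f) (hKm : Measurable K)
    (hK : Integrable K) :
    ∫ p : Plane × Plane, f (p.1 + p.2) * K p.2 ∂(volume.prod volume)
      = (∫ x, f x) * ∫ z, K z := by
  rw [integral_prod_symm _ (integrable_shear hfm hf hKm hK)]
  have (z : Plane) : ∫ x, f (x + z) * K z = (∫ x, f x) * K z := by
    rw [integral_mul_const, integral_add_right_eq_self f]
  simp only [this]
  rw [integral_const_mul]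

end Shear

/-- The measure of `Ω` minus its translate by `-z`. -/
noncomputable def transDefect (Ω : Set Plane) (z : Plane) : ℝ :=
  ∫ x, ind Ω x * (ind Ω x - ind Ω (x + z))

section Defect

variable {Ω : Set Plane} {K : Plane → ℝ}

theorem transDefect_nonneg (z : Plane) : 0 ≤ transDefect Ω z := by
  refine integral_nonneg fun x => ?_
  by_cases h : x ∈ Ω
  · have := ind_le_one Ω (x + z)
    simp only [ind, h, indicator_of_mem, Pi.one_apply, one_mul] at this ⊢
    simpa using this
  · simp [ind, h]

theorem transDefect_le (hΩ : MeasurableSet Ω) (hv : volume Ω ≠ ⊤) (z : Plane) :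
    transDefect Ω z ≤ (volume : Measure Plane).real Ω := by
  rw [← integral_ind hΩ]
  refine integral_mono_of_nonneg (Filter.Eventually.of_forall fun x => ?_) (integrable_ind hΩ hv)
    (Filter.Eventually.of_forall fun x => ?_)
  · by_cases h : x ∈ Ω
    · have := ind_le_one Ω (x + z)
      simp only [ind, h, indicator_of_mem, Pi.one_apply, one_mul] at this ⊢
      simpa using this
    · simp [ind, h]
  · have h0 := ind_nonneg Ω (x + z)
    have h1 := ind_nonneg Ω x
    have h2 := ind_le_one Ω x
    simp only
    nlinarith

theorem integrable_defect {v : Plane → ℝ} (hΩ : MeasurableSet Ω)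
    (hvm : Measurable v) (hvi : Integrable v) (hKm : Measurable K) (hK : Integrable K) :
    Integrable (fun p : Plane × Plane => ind Ω p.1 * ((v p.1 - v (p.1 + p.2)) * K p.2))
      (volume.prod volume) := by
  refine (((hvi.mul_prod hK).sub (integrable_shear hvm hvi hKm hK)).norm).mono'
    (Measurable.aestronglyMeasurable ?_) (Filter.Eventually.of_forall fun p => ?_)
  · have := measurable_ind hΩ
    fun_prop
  · rw [norm_mul, Real.norm_eq_abs, abs_of_nonneg (ind_nonneg _ _)]
    refine (mul_le_of_le_one_left (norm_nonneg _) (ind_le_one _ _)).trans_eq ?_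
    simp [sub_mul]

theorem integral_defect (hΩ : MeasurableSet Ω) (hv : volume Ω ≠ ⊤) (hKm : Measurable K)
    (hK : Integrable K) :
    Integrable (fun z => transDefect Ω z * K z) ∧
    ∫ p : Plane × Plane, ind Ω p.1 * ((ind Ω p.1 - ind Ω (p.1 + p.2)) * K p.2)
      ∂(volume.prod volume) = ∫ z, transDefect Ω z * K z := by
  have hi := integrable_defect hΩ (measurable_ind hΩ) (integrable_ind hΩ hv) hKm hK
  have h (z : Plane) : ∫ x, ind Ω x * ((ind Ω x - ind Ω (x + z)) * K z)
      = transDefect Ω z * K z := by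
    rw [transDefect, ← integral_mul_const]
    simp only [mul_assoc]
  constructor
  · simpa only [h] using hi.integral_prod_right
  · rw [integral_prod_symm _ hi]
    simp only [h]

theorem integral_transDefect_mul_le {c M : ℝ} (hΩ : MeasurableSet Ω) (hv : volume Ω ≠ ⊤)
    (hP : HasFinPer Ω) (hKm : Measurable K) (hKi : Integrable K) (hM : ∀ z, ‖K z • z‖ ≤ M)
    (hK0 : ∀ z, 1 < ‖z‖ → K z = 0) (hKn : ∀ z, 0 ≤ K z) (hKe : ∀ z, K (-z) = K z)
    (hcK : ∀ e : Plane, ‖e‖ = 1 → ∫ z, K z * |inner ℝ z e| ≤ c) (hc0 : 0 < c) :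
    ∫ z, transDefect Ω z * K z ≤ c / 2 * perim Ω := by
  have key (ε : ℝ) (hε : 0 < ε) :
      ∫ z, transDefect Ω z * K z ≤ c / 2 * perim Ω + 2 * ε * ∫ z, K z := by
    obtain ⟨u, hu, hc, hu0, hu1, hue⟩ := exists_smooth_approx_ind hΩ hv hε
    have hum := hu.continuous.measurable
    have hui := hu.continuous.integrable_of_hasCompactSupport hc (μ := volume)
    have hfm := measurable_ind hΩ
    have hfi := integrable_ind hΩ hv
    set w : Plane → ℝ := fun x => |ind Ω x - u x| with hw
    have hwm : Measurable w := by fun_prop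
    have hwi : Integrable w := (hfi.sub hui).abs
    have hK0' : 0 ≤ ∫ z, K z := integral_nonneg hKn
    have i1 := integrable_defect hΩ hfm hfi hKm hKi
    have i2 := integrable_defect hΩ hum hui hKm hKi
    have i3 := hwi.mul_prod hKi
    have i4 := integrable_shear hwm hwi hKm hKi
    have i34 : Integrable (fun p : Plane × Plane => w p.1 * K p.2 + w (p.1 + p.2) * K p.2)
      (volume.prod volume) := i3.add i4
    rw [← (integral_defect hΩ hv hKm hKi).2]
    calc _ ≤ ∫ p : Plane × Plane, (ind Ω p.1 * ((u p.1 - u (p.1 + p.2)) * K p.2)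
            + (w p.1 * K p.2 + w (p.1 + p.2) * K p.2)) ∂(volume.prod volume) := by
          refine integral_mono i1 (i2.add i34) fun p => ?_
          have a1 := le_abs_self (ind Ω p.1 - u p.1)
          have a2 := neg_abs_le (ind Ω (p.1 + p.2) - u (p.1 + p.2))
          have b1 : 0 ≤ w p.1 := abs_nonneg _
          have b2 : 0 ≤ w (p.1 + p.2) := abs_nonneg _
          have h0 := ind_nonneg Ω p.1
          have h1 := ind_le_one Ω p.1
          have hk := hKn p.2
          have e : (ind Ω p.1 - ind Ω (p.1 + p.2)) ≤
              (u p.1 - u (p.1 + p.2)) + (w p.1 + w (p.1 + p.2)) := by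
            simp only [hw]; linarith
          have e1 := mul_le_mul_of_nonneg_left (mul_le_mul_of_nonneg_right e hk) h0
          have e2 : ind Ω p.1 * ((w p.1 + w (p.1 + p.2)) * K p.2) ≤
              (w p.1 + w (p.1 + p.2)) * K p.2 :=
            mul_le_of_le_one_left (mul_nonneg (add_nonneg b1 b2) hk) h1
          simp only
          nlinarith
      _ = (∫ x in Ω, ∫ z, (u x - u (x + z)) * K z)
            + 2 * (∫ x, w x) * ∫ z, K z := by
          rw [integral_add i2 i34, integral_add i3 i4, integral_shear hwm hwi hKm hKi,
            integral_prod_mul w K, integral_prod _ i2]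
          simp only [integral_const_mul]
          rw [← integral_indicator hΩ]
          have e (x : Plane) : ind Ω x * ∫ z, (u x - u (x + z)) * K z
              = Ω.indicator (fun x => ∫ z, (u x - u (x + z)) * K z) x := by
            by_cases h : x ∈ Ω <;> simp [ind, h]
          simp only [e]
          ring
      _ ≤ _ := by
          have := setIntegral_smooth_diff_le_perim hKm hM hK0 hKn hKe hcK hc0 hu hc hu0 hu1 hP
          have := mul_le_mul_of_nonneg_right hue hK0'
          nlinarith
  refine le_of_forall_pos_le_add fun η hη => ?_
  have hK0' : 0 ≤ ∫ z, K z := integral_nonneg hKn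
  refine (key (η / (2 * (∫ z, K z) + 1)) (by positivity)).trans ?_
  gcongr
  rw [mul_div_assoc', div_mul_eq_mul_div, div_le_iff₀ (by positivity)]
  nlinarith

theorem integral_integral_ind_sub_sq (hΩ : MeasurableSet Ω) (hv : volume Ω ≠ ⊤)
    (hKm : Measurable K) (hK : Integrable K) :
    ∫ x : Plane, ∫ z : Plane, |ind Ω (x + z) - ind Ω x| ^ 2 * K z
      = 2 * ∫ z, transDefect Ω z * K z := by
  have hfm := measurable_ind hΩ
  have hfi := integrable_ind hΩ hv
  have i1 := integrable_defect hΩ hfm hfi hKm hK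
  have i2 := hfi.mul_prod hK
  have i3 := integrable_shear hfm hfi hKm hK
  have e (p : Plane × Plane) : |ind Ω (p.1 + p.2) - ind Ω p.1| ^ 2 * K p.2 =
      2 * (ind Ω p.1 * ((ind Ω p.1 - ind Ω (p.1 + p.2)) * K p.2)) +
        (ind Ω (p.1 + p.2) * K p.2 - ind Ω p.1 * K p.2) := by
    by_cases h1 : p.1 ∈ Ω <;> by_cases h2 : p.1 + p.2 ∈ Ω <;> simp [ind, h1, h2]
    ring
  have hi : Integrable (fun p : Plane × Plane => |ind Ω (p.1 + p.2) - ind Ω p.1| ^ 2 * K p.2)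
      (volume.prod volume) := by
    simp only [e]
    exact (i1.const_mul 2).add (i3.sub i2)
  have i32 : Integrable (fun p : Plane × Plane => ind Ω (p.1 + p.2) * K p.2 - ind Ω p.1 * K p.2)
      (volume.prod volume) := i3.sub i2
  rw [← integral_prod _ hi]
  simp only [e]
  rw [integral_add (i1.const_mul 2) i32, integral_sub i3 i2, integral_const_mul,
    (integral_defect hΩ hv hKm hK).2, integral_shear hfm hfi hKm hK, integral_prod_mul (ind Ω) K]
  ring

end Defect

theorem Plane.integral_comp_isometry (R : Plane ≃ₗᵢ[ℝ] Plane) (g : Plane → ℝ) :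
    ∫ x, g (R x) = ∫ x, g x :=
  R.measurePreserving.integral_comp R.toHomeomorph.measurableEmbedding g

/-- Cartesian coordinates on the plane. -/
noncomputable def Plane.coords : Plane ≃ᵐ ℝ × ℝ :=
  (MeasurableEquiv.toLp 2 (Fin 2 → ℝ)).symm.trans MeasurableEquiv.finTwoArrow

theorem Plane.coords_apply (x : Plane) : Plane.coords x = (x 0, x 1) := rfl

theorem Plane.measurePreserving_coords : MeasurePreserving Plane.coords :=
  (volume_preserving_finTwoArrow ℝ).comp
    (EuclideanSpace.volume_preserving_symm_measurableEquiv_toLp (Fin 2))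

theorem Plane.norm_eq (x : Plane) : ‖x‖ = √(x 0 ^ 2 + x 1 ^ 2) := by
  simp [EuclideanSpace.norm_eq, Fin.sum_univ_two]

theorem Plane.norm_sq_eq (x : Plane) : ‖x‖ ^ 2 = x 0 ^ 2 + x 1 ^ 2 := by
  rw [Plane.norm_eq, Real.sq_sqrt (by positivity)]

theorem transDefect_ball_isometry (R : Plane ≃ₗᵢ[ℝ] Plane) (z : Plane) :
    transDefect (Metric.ball 0 1) (R z) = transDefect (Metric.ball 0 1) z := by
  unfold transDefect
  rw [← Plane.integral_comp_isometry R]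
  have h (x : Plane) : ind (Metric.ball 0 1) (R x) = ind (Metric.ball 0 1) x := by
    simp [ind, indicator]
  simp only [← map_add, h]

theorem transDefect_ball_single {r : ℝ} (hr0 : 0 ≤ r) (hr1 : r ≤ 1) :
    2 * r - r ^ 3 / 2 ≤ transDefect (Metric.ball 0 1) (EuclideanSpace.single 1 r) := by
  set B : Set Plane := Metric.ball 0 1
  set z : Plane := EuclideanSpace.single 1 r with hz
  have hB : MeasurableSet B := measurableSet_ball
  have hBv : volume B ≠ ⊤ := measure_ball_lt_top.ne
  set a : ℝ := √(1 - r ^ 2 / 4) with ha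
  have ha0 : 0 ≤ 1 - r ^ 2 / 4 := by nlinarith
  have ha2 : a ^ 2 = 1 - r ^ 2 / 4 := Real.sq_sqrt ha0
  have han : 0 ≤ a := Real.sqrt_nonneg _
  have hage : 1 - r ^ 2 / 4 ≤ a := Real.le_sqrt_of_sq_le (by nlinarith)
  set l : ℝ → ℝ := fun y => √(1 - y ^ 2) with hl
  have hlc : Continuous l := by fun_prop
  set S : Set (ℝ × ℝ) := regionBetween (fun y => l y - r) l (Ioo (-a) a) with hS
  have hSv : (volume : Measure (ℝ × ℝ)).real S = 2 * a * r := by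
    rw [measureReal_def, hS]
    change ((volume.prod volume) _).toReal = _
    rw [volume_regionBetween_eq_integral (f := fun y => l y - r) (g := l)]
    · rw [ENNReal.toReal_ofReal]
      · have e : (fun y => (l - fun y => l y - r) y) = fun _ => r := by
          ext y
          simp
        simp only [e, setIntegral_const, measureReal_def, Real.volume_Ioo, smul_eq_mul]
        rw [ENNReal.toReal_ofReal (by linarith)]
        ring
      · refine setIntegral_nonneg measurableSet_Ioo fun y _ => ?_
        simp [hr0]
    · exact ((hlc.sub continuous_const).integrableOn_Icc).mono_set Ioo_subset_Icc_self
    · exact hlc.integrableOn_Icc.mono_set Ioo_subset_Icc_self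
    · exact measurableSet_Ioo
    · intro y _
      simp [hr0]
  have hSm : MeasurableSet S :=
    measurableSet_regionBetween (hlc.measurable.sub_const r) hlc.measurable measurableSet_Ioo
  have hTv : (volume : Measure Plane).real (Plane.coords ⁻¹' S) = 2 * a * r := by
    rw [measureReal_def, Plane.measurePreserving_coords.measure_preimage hSm.nullMeasurableSet,
      ← measureReal_def, hSv]
  have hTm : MeasurableSet (Plane.coords ⁻¹' S) := Plane.coords.measurable hSm
  have hmem : ∀ x ∈ Plane.coords ⁻¹' S, x ∈ B ∧ x + z ∉ B := by
    intro x hx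
    rw [mem_preimage, Plane.coords_apply] at hx
    obtain ⟨⟨h1, h2⟩, h3, h4⟩ := hx
    simp only at h1 h2 h3 h4
    have hy : x 0 ^ 2 ≤ 1 - r ^ 2 / 4 := by rw [← ha2]; nlinarith
    have hl2 : l (x 0) ^ 2 = 1 - x 0 ^ 2 := Real.sq_sqrt (by nlinarith)
    have hln : 0 ≤ l (x 0) := Real.sqrt_nonneg _
    have hlr : r / 2 ≤ l (x 0) := Real.le_sqrt_of_sq_le (by nlinarith)
    constructor
    · have : ‖x‖ ^ 2 < 1 := by
        rw [Plane.norm_sq_eq]; nlinarith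
      simp only [B, mem_ball_zero_iff]
      nlinarith [norm_nonneg x]
    · have : 1 ≤ ‖x + z‖ ^ 2 := by
        rw [Plane.norm_sq_eq]
        simp [hz]
        nlinarith
      simp only [B, mem_ball_zero_iff, not_lt]
      nlinarith [norm_nonneg (x + z)]
  calc 2 * r - r ^ 3 / 2 ≤ 2 * a * r := by nlinarith
    _ = ∫ x, ind (Plane.coords ⁻¹' S) x := by rw [integral_ind hTm, hTv]
    _ ≤ transDefect B z := by
      have hi : Integrable (fun x => ind B x * (ind B x - ind B (x + z))) := by
        have hi1 := integrable_ind hB hBv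
        refine (hi1.norm.add (hi1.comp_add_right z).norm).mono'
          (Measurable.aestronglyMeasurable ?_) (Filter.Eventually.of_forall fun x => ?_)
        · have := measurable_ind hB
          fun_prop
        · rw [norm_mul, Real.norm_eq_abs, abs_of_nonneg (ind_nonneg _ _)]
          exact (mul_le_of_le_one_left (norm_nonneg _) (ind_le_one _ _)).trans (norm_sub_le _ _)
      refine integral_mono_of_nonneg (Filter.Eventually.of_forall fun x => ind_nonneg _ _) hi
        (Filter.Eventually.of_forall fun x => ?_)
      by_cases hx : x ∈ Plane.coords ⁻¹' S
      · obtain ⟨h1, h2⟩ := hmem x hx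
        simp [ind, hx, h1, h2]
      · have : ind (Plane.coords ⁻¹' S) x = 0 := indicator_of_notMem hx _
        simp only [this]
        by_cases h : x ∈ B
        · have := ind_le_one B (x + z)
          simp only [ind, h, indicator_of_mem, Pi.one_apply, one_mul] at this ⊢
          simpa using this
        · simp [ind, h]

theorem transDefect_ball_ge {z : Plane} (hz : ‖z‖ ≤ 1) :
    2 * ‖z‖ - ‖z‖ ^ 3 / 2 ≤ transDefect (Metric.ball 0 1) z := by
  have h : ‖z‖ = ‖(EuclideanSpace.single 1 ‖z‖ : Plane)‖ := by simp
  have hR := Submodule.reflection_sub h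
  rw [← transDefect_ball_isometry _ z, hR]
  exact transDefect_ball_single (norm_nonneg z) hz

/-- The kernel `r⁻³` truncated to `δ < r ≤ 1`. -/
noncomputable def nearKer (δ : ℝ) : ℝ → ℝ := (Ioc δ 1).indicator fun r => (r ^ 3)⁻¹

/-- The kernel `r⁻³` truncated to `1 < r`. -/
noncomputable def farKer : ℝ → ℝ := (Ioi 1).indicator fun r => (r ^ 3)⁻¹

theorem gdel_div_eq {δ : ℝ} (hδ1 : δ < 1) (r : ℝ) :
    gdel δ r / r ^ 3 = nearKer δ r + farKer r := by
  unfold gdel nearKer farKer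
  by_cases h1 : δ < r
  · by_cases h2 : r ≤ 1
    · simp [h1, h2, indicator]
    · push Not at h2
      simp [h1, h2, indicator]
  · have : ¬ 1 < r := by linarith
    simp [h1, this, indicator]

theorem measurable_nearKer (δ : ℝ) : Measurable (nearKer δ) :=
  Measurable.indicator (by fun_prop) measurableSet_Ioc

theorem measurable_farKer : Measurable farKer :=
  Measurable.indicator (by fun_prop) measurableSet_Ioi

theorem nearKer_nonneg {δ : ℝ} (hδ : 0 < δ) (r : ℝ) : 0 ≤ nearKer δ r := by
  refine indicator_nonneg (fun r hr => ?_) r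
  have : 0 < r := hδ.trans hr.1
  positivity

theorem farKer_nonneg (r : ℝ) : 0 ≤ farKer r := by
  refine indicator_nonneg (fun r hr => ?_) r
  have : (0 : ℝ) < r := one_pos.trans hr
  positivity

theorem integral_mul_nearKer {δ : ℝ} (hδ : 0 < δ) {g : ℝ → ℝ}
    (hg : ContinuousOn g (Icc δ 1)) :
    IntegrableOn (fun r => g r * nearKer δ r) (Ioi 0) ∧
    ∫ r in Ioi (0 : ℝ), g r * nearKer δ r = ∫ r in Ioc δ 1, g r * (r ^ 3)⁻¹ := by
  have e : (fun r => g r * nearKer δ r) = (Ioc δ 1).indicator fun r => g r * (r ^ 3)⁻¹ := by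
    ext r
    by_cases h : r ∈ Ioc δ 1 <;> simp [nearKer, h]
  have hi : IntegrableOn (fun r => g r * (r ^ 3)⁻¹) (Ioc δ 1) := by
    refine (ContinuousOn.integrableOn_Icc ?_).mono_set Ioc_subset_Icc_self
    refine hg.mul (ContinuousOn.inv₀ (by fun_prop) fun r hr => ?_)
    have : 0 < r := hδ.trans_le hr.1
    positivity
  rw [e]
  refine ⟨((integrable_indicator_iff measurableSet_Ioc).2 hi).integrableOn, ?_⟩
  rw [setIntegral_indicator measurableSet_Ioc, inter_eq_right.2]
  exact fun r hr => hδ.trans hr.1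

theorem integrable_nearKer {δ : ℝ} (hδ : 0 < δ) :
    Integrable (fun z : Plane => nearKer δ ‖z‖) :=
  Plane.integrable_fun_norm (integral_mul_nearKer hδ continuousOn_id).1

theorem integral_farKer : Integrable (fun z : Plane => farKer ‖z‖) ∧
    ∫ z : Plane, farKer ‖z‖ = 2 * π := by
  have e : (fun r => r * farKer r) = (Ioi 1).indicator fun r : ℝ => r ^ (-2 : ℝ) := by
    ext r
    by_cases h : r ∈ Ioi (1 : ℝ)
    · have h0 : (0 : ℝ) < r := one_pos.trans h
      simp only [farKer, h, indicator_of_mem]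
      rw [Real.rpow_neg h0.le, Real.rpow_two]
      field_simp
    · simp [farKer, h]
  constructor
  · refine Plane.integrable_fun_norm ?_
    rw [e]
    exact ((integrable_indicator_iff measurableSet_Ioi).2
      (integrableOn_Ioi_rpow_of_lt (by norm_num) one_pos)).integrableOn
  · rw [Plane.integral_fun_norm, e, setIntegral_indicator measurableSet_Ioi, inter_eq_right.2,
      integral_Ioi_rpow_of_lt (by norm_num) one_pos]
    · norm_num
    · exact Ioi_subset_Ioi zero_le_one

theorem setIntegral_Ioc_inv {δ : ℝ} (hδ : 0 < δ) (hδ1 : δ < 1) :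
    ∫ r in Ioc δ 1, r⁻¹ = |Real.log δ| := by
  rw [← intervalIntegral.integral_of_le hδ1.le, integral_inv_of_pos hδ one_pos,
    abs_of_neg (Real.log_neg hδ hδ1), one_div, Real.log_inv]

theorem integral_abs_sin : ∫ θ in Ioo (-π) π, |Real.sin θ| = 4 := by
  have hpi := Real.pi_pos
  rw [← integral_Ioc_eq_integral_Ioo, ← intervalIntegral.integral_of_le (by linarith),
    ← intervalIntegral.integral_add_adjacent_intervals (b := 0)
      (Continuous.intervalIntegrable (by fun_prop) _ _)
      (Continuous.intervalIntegrable (by fun_prop) _ _)]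
  have h1 : ∫ θ in (-π)..0, |Real.sin θ| = ∫ θ in (-π)..0, - Real.sin θ := by
    refine intervalIntegral.integral_congr fun θ hθ => ?_
    rw [uIcc_of_le (by linarith)] at hθ
    exact abs_of_nonpos (Real.sin_nonpos_of_nonpos_of_neg_pi_le hθ.2 hθ.1)
  have h2 : ∫ θ in (0 : ℝ)..π, |Real.sin θ| = ∫ θ in (0 : ℝ)..π, Real.sin θ := by
    refine intervalIntegral.integral_congr fun θ hθ => ?_
    rw [uIcc_of_le hpi.le] at hθ
    exact abs_of_nonneg (Real.sin_nonneg_of_nonneg_of_le_pi hθ.1 hθ.2)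
  rw [h1, h2, intervalIntegral.integral_neg, integral_sin, integral_sin]
  norm_num

theorem integral_nearKer_mul_abs_inner {δ : ℝ} (hδ : 0 < δ) (hδ1 : δ < 1) {e : Plane}
    (he : ‖e‖ = 1) : ∫ z : Plane, nearKer δ ‖z‖ * |inner ℝ z e| = 4 * |Real.log δ| := by
  have h : ‖(EuclideanSpace.single 1 (1 : ℝ) : Plane)‖ = ‖e‖ := by simp [he]
  have hR := Submodule.reflection_sub h
  set R := (ℝ ∙ ((EuclideanSpace.single 1 (1 : ℝ) : Plane) - e))ᗮ.reflection
  rw [← Plane.integral_comp_isometry R, ← hR]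
  simp only [LinearIsometryEquiv.norm_map, LinearIsometryEquiv.inner_map_map]
  have e1 (z : Plane) : nearKer δ ‖z‖ * |inner ℝ z (EuclideanSpace.single 1 (1 : ℝ) : Plane)|
      = (fun p : ℝ × ℝ => nearKer δ (√(p.1 ^ 2 + p.2 ^ 2)) * |p.2|) (Plane.coords z) := by
    simp [Plane.coords_apply, Plane.norm_eq, EuclideanSpace.inner_single_right]
  rw [integral_congr_ae (Filter.Eventually.of_forall e1),
    Plane.measurePreserving_coords.integral_comp Plane.coords.measurableEmbedding
      (fun p : ℝ × ℝ => nearKer δ (√(p.1 ^ 2 + p.2 ^ 2)) * |p.2|),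
    ← integral_comp_polarCoord_symm, polarCoord_target]
  have e2 : ∀ p ∈ Ioi (0 : ℝ) ×ˢ Ioo (-π) π,
      p.1 • (fun p : ℝ × ℝ => nearKer δ (√(p.1 ^ 2 + p.2 ^ 2)) * |p.2|) (polarCoord.symm p)
      = (p.1 ^ 2 * nearKer δ p.1) * |Real.sin p.2| := by
    rintro ⟨r, θ⟩ ⟨hr, -⟩
    have hr0 : 0 < r := hr
    have : (r * Real.cos θ) ^ 2 + (r * Real.sin θ) ^ 2 = r ^ 2 := by
      nlinarith [Real.sin_sq_add_cos_sq θ]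
    simp only [polarCoord_symm_apply, this, Real.sqrt_sq hr0.le, abs_mul, abs_of_pos hr0,
      smul_eq_mul]
    ring
  rw [setIntegral_congr_fun (measurableSet_Ioi.prod measurableSet_Ioo) e2]
  rw [Measure.volume_eq_prod, setIntegral_prod_mul (fun r : ℝ => r ^ 2 * nearKer δ r)
      (fun θ => |Real.sin θ|),
    integral_abs_sin, (integral_mul_nearKer hδ (by fun_prop)).2, ← setIntegral_Ioc_inv hδ hδ1,
    mul_comm]
  congr 1
  refine setIntegral_congr_fun measurableSet_Ioc fun r hr => ?_
  have : 0 < r := hδ.trans hr.1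
  field_simp

theorem integral_transDefect_ball_nearKer_ge {δ : ℝ} (hδ : 0 < δ) (hδ1 : δ < 1)
    (hi : Integrable fun z => transDefect (Metric.ball 0 1) z * nearKer δ ‖z‖) :
    4 * π * |Real.log δ| - π ≤ ∫ z, transDefect (Metric.ball 0 1) z * nearKer δ ‖z‖ := by
  have hc : ContinuousOn (fun r : ℝ => r * (2 * r - r ^ 3 / 2)) (Icc δ 1) := by fun_prop
  obtain ⟨h1, h2⟩ := integral_mul_nearKer hδ hc
  have h1' : IntegrableOn (fun r : ℝ => r * ((2 * r - r ^ 3 / 2) * nearKer δ r)) (Ioi 0) := by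
    simpa only [mul_assoc] using h1
  have hle : ∫ z : Plane, (2 * ‖z‖ - ‖z‖ ^ 3 / 2) * nearKer δ ‖z‖
      ≤ ∫ z, transDefect (Metric.ball 0 1) z * nearKer δ ‖z‖ := by
    refine integral_mono (Plane.integrable_fun_norm h1') hi fun z => ?_
    by_cases hz : ‖z‖ ≤ 1
    · exact mul_le_mul_of_nonneg_right (transDefect_ball_ge hz) (nearKer_nonneg hδ _)
    · have : nearKer δ ‖z‖ = 0 := indicator_of_notMem (fun h => hz h.2) _
      simp [this]
  refine le_trans ?_ hle
  rw [Plane.integral_fun_norm (fun r => (2 * r - r ^ 3 / 2) * nearKer δ r)]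
  rw [show (fun r => r * ((2 * r - r ^ 3 / 2) * nearKer δ r)) = fun r =>
    r * (2 * r - r ^ 3 / 2) * nearKer δ r by simp only [mul_assoc], h2]
  have e : ∫ r in Ioc δ 1, r * (2 * r - r ^ 3 / 2) * (r ^ 3)⁻¹
      = ∫ r in Ioc δ 1, (2 * r⁻¹ - r / 2) := by
    refine setIntegral_congr_fun measurableSet_Ioc fun r hr => ?_
    have : 0 < r := hδ.trans hr.1
    field_simp
  have hlow : 2 * |Real.log δ| - 1 / 2 ≤ ∫ r in Ioc δ 1, (2 * r⁻¹ - r / 2) := by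
    have hinv : IntegrableOn (fun r : ℝ => r⁻¹) (Ioc δ 1) := by
      refine (ContinuousOn.integrableOn_Icc ?_).mono_set Ioc_subset_Icc_self
      exact continuousOn_inv₀.mono fun r hr => (hδ.trans_le hr.1).ne'
    have hid : IntegrableOn (fun r : ℝ => r / 2) (Ioc δ 1) :=
      (Continuous.integrableOn_Icc (by fun_prop)).mono_set Ioc_subset_Icc_self
    rw [integral_sub (hinv.const_mul 2) hid, integral_const_mul, setIntegral_Ioc_inv hδ hδ1]
    have : ∫ r in Ioc δ 1, r / 2 ≤ 1 / 2 := by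
      rw [← intervalIntegral.integral_of_le hδ1.le, intervalIntegral.integral_div, integral_id]
      nlinarith
    linarith
  rw [e]
  nlinarith [Real.pi_pos]

theorem integral_transDefect_mul_nearKer_le {δ : ℝ} (hδ : 0 < δ) (hδ1 : δ < 1) {Ω : Set Plane}
    (hΩ : MeasurableSet Ω) (hv : volume Ω ≠ ⊤) (hP : HasFinPer Ω) :
    ∫ z, transDefect Ω z * nearKer δ ‖z‖ ≤ 2 * |Real.log δ| * perim Ω := by
  have hlog : 0 < |Real.log δ| := abs_pos.2 (Real.log_neg hδ hδ1).ne
  have h := integral_transDefect_mul_le (K := fun z => nearKer δ ‖z‖) (c := 4 * |Real.log δ|)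
    (M := (δ ^ 3)⁻¹) hΩ hv hP ((measurable_nearKer δ).comp measurable_norm)
    (integrable_nearKer hδ) (fun z => ?_) (fun z hz => ?_) (fun z => nearKer_nonneg hδ _)
    (fun z => by simp only [norm_neg])
    (fun e he => (integral_nearKer_mul_abs_inner hδ hδ1 he).le) (by positivity)
  · linarith
  · by_cases hz : ‖z‖ ∈ Ioc δ 1
    · have h0 : 0 < ‖z‖ := hδ.trans hz.1
      rw [nearKer, indicator_of_mem hz, norm_smul, Real.norm_of_nonneg (by positivity)]
      refine (mul_le_of_le_one_right (by positivity) hz.2).trans ?_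
      have := hz.1.le
      gcongr
    · rw [nearKer, indicator_of_notMem hz, zero_smul, norm_zero]
      positivity
  · exact indicator_of_notMem (fun h => hz.not_ge h.2) _

theorem nlE_eq {δ : ℝ} (hδ : 0 < δ) (hδ1 : δ < 1) {Ω : Set Plane} (hΩ : MeasurableSet Ω)
    (hv : volume Ω ≠ ⊤) :
    nlE δ Ω = 2 * ((∫ z, transDefect Ω z * nearKer δ ‖z‖) + ∫ z, transDefect Ω z * farKer ‖z‖) := by
  have hnm : Measurable fun z : Plane => nearKer δ ‖z‖ := (measurable_nearKer δ).comp measurable_norm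
  have hfm : Measurable fun z : Plane => farKer ‖z‖ := measurable_farKer.comp measurable_norm
  have hni := integrable_nearKer hδ
  have hfi := integral_farKer.1
  unfold nlE
  simp only [gdel_div_eq hδ1]
  rw [integral_integral_ind_sub_sq (K := fun z => nearKer δ ‖z‖ + farKer ‖z‖) hΩ hv
    (hnm.add hfm) (hni.add hfi)]
  simp only [mul_add]
  rw [integral_add (integral_defect hΩ hv hnm hni).1 (integral_defect hΩ hv hfm hfi).1, mul_add]

/-- The nonlocal term is controlled by the perimeter, uniformly in `δ`. -/
theorem nlE_le {δ : ℝ} (hδ : 0 < δ) (hδ1 : δ < 1) {Ω : Set Plane} (hΩ : MeasurableSet Ω)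
    (hv : volume Ω ≠ ⊤) (hP : HasFinPer Ω) :
    nlE δ Ω ≤ 4 * |Real.log δ| * perim Ω + 4 * π * (volume : Measure Plane).real Ω := by
  have hfi := integral_farKer.1
  have hfar : ∫ z, transDefect Ω z * farKer ‖z‖ ≤ (volume : Measure Plane).real Ω * (2 * π) := by
    rw [← integral_farKer.2, ← integral_const_mul]
    exact integral_mono (integral_defect hΩ hv (measurable_farKer.comp measurable_norm) hfi).1
      (hfi.const_mul _) fun z =>
        mul_le_mul_of_nonneg_right (transDefect_le hΩ hv z) (farKer_nonneg _)
  rw [nlE_eq hδ hδ1 hΩ hv]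
  linarith [integral_transDefect_mul_nearKer_le hδ hδ1 hΩ hv hP]

theorem nlE_ball_ge {δ : ℝ} (hδ : 0 < δ) (hδ1 : δ < 1) :
    8 * π * |Real.log δ| - 2 * π ≤ nlE δ (Metric.ball 0 1) := by
  have hv : volume (Metric.ball (0 : Plane) 1) ≠ ⊤ := measure_ball_lt_top.ne
  have hnear := integral_transDefect_ball_nearKer_ge hδ hδ1
    (integral_defect measurableSet_ball hv ((measurable_nearKer δ).comp measurable_norm)
      (integrable_nearKer hδ)).1
  have hfar : 0 ≤ ∫ z, transDefect (Metric.ball 0 1) z * farKer ‖z‖ :=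
    integral_nonneg fun z => mul_nonneg (transDefect_nonneg z) (farKer_nonneg _)
  rw [nlE_eq hδ hδ1 measurableSet_ball hv]
  linarith

/-- Uniform isoperimetric-deficit bound for minimizers of mass `π`. -/
theorem stmt17 :
    ∃ C : ℝ, 0 < C ∧ ∀ lam δ : ℝ, 0 < lam → lam < 1 → 0 < δ → δ < 1 / 2 →
      ∀ Ω : Set Plane, MeasurableSet Ω → HasFinPer Ω →
        volume Ω = ENNReal.ofReal Real.pi →
        (∀ Ω' : Set Plane, MeasurableSet Ω' → HasFinPer Ω' →
          volume Ω' = ENNReal.ofReal Real.pi → Eenergy lam δ Ω ≤ Eenergy lam δ Ω') →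
        perim Ω - 2 * Real.pi ≤ C * lam / ((1 - lam) * |Real.log δ|) := by
  have hpi := Real.pi_pos
  refine ⟨π ^ 2 + π / 2, by positivity, fun lam δ hl0 hl1 hδ hδ2 Ω hΩ hP hv hmin => ?_⟩
  have hδ1 : δ < 1 := by linarith
  have hℓ : 0 < |Real.log δ| := abs_pos.2 (Real.log_neg hδ hδ1).ne
  have hvr : (volume : Measure Plane).real Ω = π := by
    rw [measureReal_def, hv, ENNReal.toReal_ofReal hpi.le]
  have hvB : volume (Metric.ball (0 : Plane) 1) = ENNReal.ofReal π := by
    rw [← Plane.volume_real_ball, measureReal_def, ENNReal.ofReal_toReal measure_ball_lt_top.ne]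
  have hE := hmin (Metric.ball 0 1) measurableSet_ball hasFinPer_ball hvB
  have h1 := nlE_le hδ hδ1 hΩ (hv ▸ ENNReal.ofReal_ne_top) hP
  rw [hvr] at h1
  have h2 := nlE_ball_ge hδ hδ1
  have h3 := perim_ball_le
  unfold Eenergy at hE
  set ℓ := |Real.log δ|
  have hc : 0 < lam / (4 * ℓ) := by positivity
  have h1' := mul_le_mul_of_nonneg_left h1 hc.le
  have h2' := mul_le_mul_of_nonneg_left h2 hc.le
  have e1 : lam / (4 * ℓ) * (4 * ℓ * perim Ω + 4 * π * π)
      = lam * perim Ω + lam * π ^ 2 / ℓ := by field_simp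
  have e2 : lam / (4 * ℓ) * (8 * π * ℓ - 2 * π) = lam * (2 * π) - lam * (π / 2) / ℓ := by
    field_simp
    ring
  have hmain : (perim Ω - 2 * π) * (1 - lam) ≤ (π ^ 2 + π / 2) * lam / ℓ := by
    have e3 : (π ^ 2 + π / 2) * lam / ℓ = lam * π ^ 2 / ℓ + lam * (π / 2) / ℓ := by ring
    linarith
  rw [mul_comm (1 - lam), ← div_div]
  exact (le_div_iff₀ (by linarith)).2 hmain
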